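/- Let $M_1 \in \mathbb{R}^{N_1 \times N_1}$ and $M_2 \in \mathbb{R}^{N_2 \times N_2}$ be symmetric positive definite, let $G_1 \in \mathbb{R}^{N_\gamma \times N_1}$, $G_2 \in \mathbb{R}^{N_\gamma \times N_2}$ with $G_2$ of full row rank ($\operatorname{rank} G_2 = N_\gamma$), and let $\widetilde{U}_0 \in \mathbb{R}^{N_1 \times N_R}$ have linearly independent columns. Set $\widetilde{M}_1 := \widetilde{U}_0^T M_1 \widetilde{U}_0$ and $\widetilde{G}_1 := G_1 \widetilde{U}_0$. Then the ROM-FEM Schur complement $\widetilde{S} := \widetilde{G}_1 \widetilde{M}_1^{-1} \widetilde{G}_1^T + G_2 M_2^{-1} G_2^T$ is symmetric positive definite; in particular, $\widetilde{S}$ is nonsingular. -/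

import Mathlib

open Matrix

/-- A matrix over a field whose rank is its number of rows has an injective `vecMul`. -/
theorem Matrix.vecMul_injective_of_rank_eq_card {m n K : Type*} [Fintype m] [Fintype n] [Field K]
    {A : Matrix m n K} (hA : A.rank = Fintype.card m) : Function.Injective A.vecMul := by
  rw [vecMul_injective_iff, linearIndependent_iff_card_eq_finrank_span, ← hA,
    rank_eq_finrank_span_row, Set.finrank]

/-- The ROM-FEM Schur complement `S̃ = G̃₁ M̃₁⁻¹ G̃₁ᵀ + G₂ M₂⁻¹ G₂ᵀ`, with
`M̃₁ = Ũ₀ᵀ M₁ Ũ₀` and `G̃₁ = G₁ Ũ₀`, is symmetric positive definite (hence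
nonsingular) when `M₁, M₂` are SPD, `G₂` has full row rank, and `Ũ₀` has
linearly independent columns. -/
theorem rom_fem_schur_complement_posDef
    {N1 N2 Nγ NR : ℕ}
    (M1 : Matrix (Fin N1) (Fin N1) ℝ) (M2 : Matrix (Fin N2) (Fin N2) ℝ)
    (G1 : Matrix (Fin Nγ) (Fin N1) ℝ) (G2 : Matrix (Fin Nγ) (Fin N2) ℝ)
    (U0 : Matrix (Fin N1) (Fin NR) ℝ)
    (hM1 : M1.PosDef) (hM2 : M2.PosDef)
    (hG2 : G2.rank = Nγ)
    (hU0 : LinearIndependent ℝ (fun j : Fin NR => fun i : Fin N1 => U0 i j)) :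
    ((G1 * U0) * (U0ᵀ * M1 * U0)⁻¹ * (G1 * U0)ᵀ + G2 * M2⁻¹ * G2ᵀ).PosDef ∧
      IsUnit ((G1 * U0) * (U0ᵀ * M1 * U0)⁻¹ * (G1 * U0)ᵀ + G2 * M2⁻¹ * G2ᵀ).det := by
  have hG2_inj : Function.Injective G2.vecMul :=
    vecMul_injective_of_rank_eq_card (by simpa using hG2)
  have hROM : ((G1 * U0) * (U0ᵀ * M1 * U0)⁻¹ * (G1 * U0)ᵀ).PosSemidef := by
    simpa only [conjTranspose_eq_transpose_of_trivial] using
      (hM1.posSemidef.conjTranspose_mul_mul_same U0).inv.mul_mul_conjTranspose_same (G1 * U0)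
  have hFEM : (G2 * M2⁻¹ * G2ᵀ).PosDef := by
    simpa only [conjTranspose_eq_transpose_of_trivial] using
      hM2.inv.mul_mul_conjTranspose_same hG2_inj
  have hS := PosDef.posSemidef_add hROM hFEM
  exact ⟨hS, (isUnit_iff_isUnit_det _).mp hS.isUnit⟩
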